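/- Fix an integer k ≥ 1 and let A^k f : ℂ³ → ℂ³ be A^k f(x,y,z) = (x⁴+yx+z^k x², y, z). Each of the following four polynomial vector fields on ℂ³ (in coordinates (X,Y,Z)) is liftable over A^k f: η̃¹ = (4kX, 3kY, 2Z); η̃² = (−9kY²Z^{k−1}−16kXZ^{2k−1}, 12kYZ^{2k−1}, 48X+4Z^{2k}); η̃³ = (kYZ^{2k−1}, −8kXZ^{k−1}−2kZ^{3k−1}, 6Y); η̃⁴ = (−9kY³−24kXYZ^{k}, 64kX²+12kY²Z^{k}+16kXZ^{2k}, 4YZ^{k+1}). -/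

import Mathlib

open Filter Topology

/-- A vector-field germ `η` on `(ℂᵖ,0)` is liftable over the map-germ
`g : (ℂⁿ,0) → (ℂᵖ,0)` if there is a holomorphic germ `ξ` on `(ℂⁿ,0)` with
`dg(x)(ξ(x)) = η(g(x))` near `0`. -/
def Liftable {n p : ℕ} (g : (Fin n → ℂ) → (Fin p → ℂ))
    (η : (Fin p → ℂ) → (Fin p → ℂ)) : Prop :=
  ∃ ξ : (Fin n → ℂ) → (Fin n → ℂ), AnalyticAt ℂ ξ 0 ∧
    ∀ᶠ x in 𝓝 (0 : Fin n → ℂ), fderiv ℂ g x (ξ x) = η (g x)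

open scoped ContDiff

theorem fderiv_augmentedSwallowtail_apply (k : ℕ) (v w : Fin 3 → ℂ) :
    fderiv ℂ (fun v : Fin 3 → ℂ =>
      ![(v 0) ^ 4 + v 1 * v 0 + (v 2) ^ k * (v 0) ^ 2, v 1, v 2]) v w =
      ![(4 * (v 0) ^ 3 + v 1 + 2 * (v 2) ^ k * v 0) * w 0 + v 0 * w 1
          + k * (v 2) ^ (k - 1) * (v 0) ^ 2 * w 2, w 1, w 2] := by
  have h (i : Fin 3) : HasFDerivAt (fun v : Fin 3 → ℂ => v i)
      (ContinuousLinearMap.proj (R := ℂ) (φ := fun _ : Fin 3 => ℂ) i) v :=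
    hasFDerivAt_apply i v
  obtain ⟨D, hX, hD⟩ : ∃ D : (Fin 3 → ℂ) →L[ℂ] ℂ,
      HasFDerivAt (fun v : Fin 3 → ℂ => (v 0) ^ 4 + v 1 * v 0 + (v 2) ^ k * (v 0) ^ 2) D v ∧
      D w = (4 * (v 0) ^ 3 + v 1 + 2 * (v 2) ^ k * v 0) * w 0 + v 0 * w 1
        + k * (v 2) ^ (k - 1) * (v 0) ^ 2 * w 2 := by
    refine ⟨_, (((h 0).pow 4).add ((h 1).mul (h 0))).add (((h 2).pow k).mul ((h 0).pow 2)), ?_⟩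
    simp
    ring
  have hg : HasFDerivAt (fun v : Fin 3 → ℂ =>
      ![(v 0) ^ 4 + v 1 * v 0 + (v 2) ^ k * (v 0) ^ 2, v 1, v 2])
      (.pi ![D, .proj 1, .proj 2] : (Fin 3 → ℂ) →L[ℂ] Fin 3 → ℂ) v := by
    refine hasFDerivAt_pi'' fun i => ?_
    fin_cases i
    · exact hX
    · exact h 1
    · exact h 2
  rw [hg.fderiv]
  ext i
  fin_cases i
  · exact hD
  · rfl
  · rfl

/-- A field is liftable over the augmented swallowtail as soon as its first component,
pulled back and corrected by the other two, is a holomorphic multiple `q` of `∂X/∂x`. -/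
theorem liftable_augmentedSwallowtail_of_eq (k : ℕ) (a b c q : (Fin 3 → ℂ) → ℂ)
    (hb : ContDiff ℂ ω b) (hc : ContDiff ℂ ω c) (hq : ContDiff ℂ ω q)
    (h : ∀ v : Fin 3 → ℂ,
      let V := ![(v 0) ^ 4 + v 1 * v 0 + (v 2) ^ k * (v 0) ^ 2, v 1, v 2]
      (4 * (v 0) ^ 3 + v 1 + 2 * (v 2) ^ k * v 0) * q v + v 0 * b V
        + k * (v 2) ^ (k - 1) * (v 0) ^ 2 * c V = a V) :
    Liftable (fun v : Fin 3 → ℂ =>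
      ![(v 0) ^ 4 + v 1 * v 0 + (v 2) ^ k * (v 0) ^ 2, v 1, v 2])
      (fun V => ![a V, b V, c V]) := by
  have hg : ContDiff ℂ ω (fun v : Fin 3 → ℂ =>
      ![(v 0) ^ 4 + v 1 * v 0 + (v 2) ^ k * (v 0) ^ 2, v 1, v 2]) := by
    refine contDiff_pi.2 fun i => ?_
    fin_cases i
    · change ContDiff ℂ ω fun v : Fin 3 → ℂ => (v 0) ^ 4 + v 1 * v 0 + (v 2) ^ k * (v 0) ^ 2
      fun_prop
    · exact contDiff_apply ℂ ℂ 1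
    · exact contDiff_apply ℂ ℂ 2
  refine ⟨fun v => ![q v,
    b ![(v 0) ^ 4 + v 1 * v 0 + (v 2) ^ k * (v 0) ^ 2, v 1, v 2],
    c ![(v 0) ^ 4 + v 1 * v 0 + (v 2) ^ k * (v 0) ^ 2, v 1, v 2]],
    ContDiffAt.analyticAt (contDiff_pi.2 fun i => ?_).contDiffAt, .of_forall fun v => ?_⟩
  · fin_cases i
    · exact hq
    · exact hb.comp hg
    · exact hc.comp hg
  · rw [fderiv_augmentedSwallowtail_apply]
    ext i
    fin_cases i
    · exact h v
    · rfl
    · rfl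

/-- for `k ≥ 1`, the four listed polynomial vector fields on `ℂ³` are
liftable over the augmentation `A^k f(x,y,z) = (x⁴+yx+z^k x², y, z)`. -/
theorem liftable_fields_of_augmented_swallowtail
    (k : ℕ) (hk : 1 ≤ k)
    (Akf : (Fin 3 → ℂ) → (Fin 3 → ℂ))
    (hAkf : ∀ v : Fin 3 → ℂ,
      Akf v = ![(v 0) ^ 4 + v 1 * v 0 + (v 2) ^ k * (v 0) ^ 2, v 1, v 2]) :
    Liftable Akf (fun V => ![4 * (k : ℂ) * V 0, 3 * (k : ℂ) * V 1, 2 * V 2]) ∧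
    Liftable Akf (fun V =>
      ![-9 * (k : ℂ) * (V 1) ^ 2 * (V 2) ^ (k - 1)
          - 16 * (k : ℂ) * V 0 * (V 2) ^ (2 * k - 1),
        12 * (k : ℂ) * V 1 * (V 2) ^ (2 * k - 1),
        48 * V 0 + 4 * (V 2) ^ (2 * k)]) ∧
    Liftable Akf (fun V =>
      ![(k : ℂ) * V 1 * (V 2) ^ (2 * k - 1),
        -8 * (k : ℂ) * V 0 * (V 2) ^ (k - 1) - 2 * (k : ℂ) * (V 2) ^ (3 * k - 1),
        6 * V 1]) ∧
    Liftable Akf (fun V =>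
      ![-9 * (k : ℂ) * (V 1) ^ 3 - 24 * (k : ℂ) * V 0 * V 1 * (V 2) ^ k,
        64 * (k : ℂ) * (V 0) ^ 2 + 12 * (k : ℂ) * (V 1) ^ 2 * (V 2) ^ k
          + 16 * (k : ℂ) * V 0 * (V 2) ^ (2 * k),
        4 * V 1 * (V 2) ^ (k + 1)]) := by
  obtain rfl : Akf = fun v => ![(v 0) ^ 4 + v 1 * v 0 + (v 2) ^ k * (v 0) ^ 2, v 1, v 2] :=
    funext hAkf
  obtain ⟨m, rfl⟩ : ∃ m, k = m + 1 := ⟨k - 1, by omega⟩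
  have h₁ : m + 1 - 1 = m := by omega
  have h₂ : 2 * (m + 1) - 1 = 2 * m + 1 := by omega
  have h₃ : 3 * (m + 1) - 1 = 3 * m + 2 := by omega
  simp only [h₁, h₂, h₃]
  refine ⟨liftable_augmentedSwallowtail_of_eq (m + 1) _ _ _
      (fun v => (m + 1) * v 0) ?_ ?_ ?_ fun v => ?_,
    liftable_augmentedSwallowtail_of_eq (m + 1) _ _ _
      (fun v => -(m + 1) * v 2 ^ m *
        (12 * v 0 ^ 3 + 10 * v 2 ^ (m + 1) * v 0 + 9 * v 1)) ?_ ?_ ?_ fun v => ?_,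
    liftable_augmentedSwallowtail_of_eq (m + 1) _ _ _
      (fun v => (m + 1) * v 2 ^ m * (2 * v 0 ^ 2 + v 2 ^ (m + 1))) ?_ ?_ ?_ fun v => ?_,
    liftable_augmentedSwallowtail_of_eq (m + 1) _ _ _
      (fun v => -(m + 1) * (16 * v 0 ^ 6 + 24 * v 2 ^ (m + 1) * v 0 ^ 4 + 28 * v 1 * v 0 ^ 3
        + 8 * v 2 ^ (2 * (m + 1)) * v 0 ^ 2 + 18 * v 2 ^ (m + 1) * v 1 * v 0
        + 9 * v 1 ^ 2)) ?_ ?_ ?_ fun v => ?_⟩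
  all_goals first
    | fun_prop
    | (simp only [Matrix.cons_val, h₁]
       push_cast
       ring)
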